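/- Let X be a Hausdorff topological space and Y any topological space. Then the density of the space F_P(X,Y) of all functions from X to Y with the topology of pointwise convergence satisfies d(F_P(X,Y)) ≤ w(X) · d(Y). -/

import Mathlib

open Cardinal

universe u v w

/-- A function between topological spaces is quasi-continuous if for every point `x` and
all open sets `U ∋ x` and `V ∋ f x` there is a nonempty open `G ⊆ U` with `f '' G ⊆ V`. -/
def QuasiContinuous {X Y : Type*} [TopologicalSpace X] [TopologicalSpace Y] (f : X → Y) : Prop :=
  ∀ x : X, ∀ U : Set X, IsOpen U → x ∈ U → ∀ V : Set Y, IsOpen V → f x ∈ V →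
    ∃ G : Set X, IsOpen G ∧ G.Nonempty ∧ G ⊆ U ∧ f '' G ⊆ V

/-- `QP X Y` : the quasi-continuous functions from `X` to `Y`, topologized as a subspace of
the product topology on `X → Y` (topology of pointwise convergence). -/
abbrev QP (X Y : Type*) [TopologicalSpace X] [TopologicalSpace Y] :=
  {f : X → Y // QuasiContinuous f}

/-- `CP X Y` : the continuous functions from `X` to `Y` with the topology of
pointwise convergence. -/
abbrev CP (X Y : Type*) [TopologicalSpace X] [TopologicalSpace Y] :=
  {f : X → Y // Continuous f}

/-- The weight of a topological space: `ℵ₀ +` the least cardinality of a basis. -/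
noncomputable def weight (Z : Type u) [TopologicalSpace Z] : Cardinal.{u} :=
  ℵ₀ + sInf {c | ∃ B : Set (Set Z), TopologicalSpace.IsTopologicalBasis B ∧ #B = c}

/-- A network of a space: a family of (arbitrary) subsets such that every open `U ∋ z`
contains some member of the family containing `z`. -/
def IsNetwork {Z : Type u} [TopologicalSpace Z] (N : Set (Set Z)) : Prop :=
  ∀ z : Z, ∀ U : Set Z, IsOpen U → z ∈ U → ∃ A ∈ N, z ∈ A ∧ A ⊆ U

/-- Network weight: `ℵ₀ +` the least cardinality of a network. -/
noncomputable def netWeight (Z : Type u) [TopologicalSpace Z] : Cardinal.{u} :=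
  ℵ₀ + sInf {c | ∃ N : Set (Set Z), IsNetwork N ∧ #N = c}

/-- Density: `ℵ₀ +` the least cardinality of a dense subset. -/
noncomputable def density (Z : Type u) [TopologicalSpace Z] : Cardinal.{u} :=
  ℵ₀ + sInf {c | ∃ D : Set Z, Dense D ∧ #D = c}

/-- Lindelöf degree: `ℵ₀ +` the least cardinal `η` such that every open cover has a
subcover of cardinality at most `η`. -/
noncomputable def lindelofDegree (X : Type u) [TopologicalSpace X] : Cardinal.{u} :=
  ℵ₀ + sInf {η | ∀ V : Set (Set X), (∀ U ∈ V, IsOpen U) → ⋃₀ V = Set.univ →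
      ∃ W ⊆ V, #W ≤ η ∧ ⋃₀ W = Set.univ}

/-- Tightness: `ℵ₀ +` the least cardinal `η` such that whenever `z ∈ closure A` there is
`B ⊆ A` with `#B ≤ η` and `z ∈ closure B`. -/
noncomputable def tightness (Z : Type u) [TopologicalSpace Z] : Cardinal.{u} :=
  ℵ₀ + sInf {η | ∀ z : Z, ∀ A : Set Z, z ∈ closure A →
      ∃ B ⊆ A, #B ≤ η ∧ z ∈ closure B}

/-- Pseudocharacter of a space: the sup over points `z` of `ℵ₀ +` the least cardinality of a
family of open sets whose intersection is `{z}`. -/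
noncomputable def pseudoChar (Z : Type u) [TopologicalSpace Z] : Cardinal.{u} :=
  ⨆ z : Z, (ℵ₀ + sInf {c | ∃ γ : Set (Set Z), (∀ U ∈ γ, IsOpen U) ∧ ⋂₀ γ = {z} ∧ #γ = c})

/-- Weak covering number: `ℵ₀ +` the least cardinality of a family of open sets whose union
is dense. -/
noncomputable def weakCov (X : Type u) [TopologicalSpace X] : Cardinal.{u} :=
  ℵ₀ + sInf {c | ∃ J : Set (Set X), (∀ U ∈ J, IsOpen U) ∧ closure (⋃₀ J) = Set.univ ∧ #J = c}

/-- Cardinal logarithm: the least `μ` with `κ ≤ 2 ^ μ`. -/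
noncomputable def cardLog (κ : Cardinal.{u}) : Cardinal.{u} :=
  sInf {μ | κ ≤ 2 ^ μ}

/-- i-weight: `ℵ₀ +` the least weight of a space onto which `Z` admits a continuous
bijection. -/
noncomputable def iWeight (Z : Type u) [TopologicalSpace Z] : Cardinal.{u} :=
  ℵ₀ + sInf {c | ∃ (W : Type u) (_ : TopologicalSpace W) (f : Z → W),
      Continuous f ∧ Function.Bijective f ∧ weight W = c}

open Classical in
/-- Step functions: the first listed set containing `x` decides the value. -/
noncomputable def stepFun {X : Type u} {Y : Type v} {B : Set (Set X)} {D : Set Y} (g : X → Y) :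
    List (B × D) → X → Y
  | [] => g
  | p :: l => fun x => if x ∈ (p.1 : Set X) then (p.2 : Y) else stepFun g l x

theorem exists_stepFun {X : Type u} {Y : Type v} [TopologicalSpace X] [T2Space X]
    [TopologicalSpace Y] {B : Set (Set X)} {D : Set Y}
    (hB : TopologicalSpace.IsTopologicalBasis B) (hD : Dense D) (g : X → Y)
    (V : X → Set Y) (J : Finset X) (hV : ∀ x ∈ J, IsOpen (V x) ∧ (V x).Nonempty) :
    ∃ l : List (B × D), ∀ x ∈ J, stepFun g l x ∈ V x := by
  classical
  induction J using Finset.induction_on with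
  | empty => exact ⟨[], by simp⟩
  | insert a J ha ih =>
    obtain ⟨l, hl⟩ := ih (fun x hx => hV x (Finset.mem_insert_of_mem hx))
    obtain ⟨ho, hne⟩ := hV a (Finset.mem_insert_self a J)
    obtain ⟨d, hdV, hdD⟩ := hD.inter_open_nonempty _ ho hne
    have hopen : IsOpen ((J : Set X)ᶜ) := J.finite_toSet.isClosed.isOpen_compl
    obtain ⟨U, hU, haU, hUJ⟩ := hB.exists_subset_of_mem_open
      (show a ∈ (J : Set X)ᶜ by simpa using ha) hopen
    refine ⟨(⟨U, hU⟩, ⟨d, hdD⟩) :: l, ?_⟩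
    intro x hx
    rcases Finset.mem_insert.1 hx with rfl | hx
    · simpa [stepFun, haU] using hdV
    · have hxU : x ∉ U := fun h => hUJ h (by simpa using hx)
      simpa [stepFun, hxU] using hl x hx

theorem dense_stepFun {X : Type u} {Y : Type v} [TopologicalSpace X] [T2Space X]
    [TopologicalSpace Y] {B : Set (Set X)} {D : Set Y}
    (hB : TopologicalSpace.IsTopologicalBasis B) (hD : Dense D) (g : X → Y) :
    Dense (Set.range (stepFun (B := B) (D := D) g)) := by
  rw [dense_iff_inter_open]
  rintro W hW ⟨f, hf⟩
  obtain ⟨I, V, hV, hsub⟩ := isOpen_pi_iff.1 hW f hf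
  obtain ⟨l, hl⟩ := exists_stepFun hB hD g V I (fun x hx => ⟨(hV x hx).1, _, (hV x hx).2⟩)
  exact ⟨stepFun g l, hsub (fun x hx => hl x hx), l, rfl⟩

/-- For a Hausdorff space `X` and any space `Y`,
`d(F_P(X,Y)) ≤ w(X) · d(Y)`, where `F_P(X,Y)` is `Y^X` with the product topology. -/
theorem stmt9 (X : Type u) (Y : Type v) [TopologicalSpace X] [T2Space X]
    [TopologicalSpace Y] :
    density (X → Y) ≤ Cardinal.lift.{v} (weight X) * Cardinal.lift.{u} (density Y) := by
  obtain ⟨B, hB, hBc⟩ := csInf_mem (s := {c | ∃ B : Set (Set X),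
    TopologicalSpace.IsTopologicalBasis B ∧ #B = c})
    ⟨_, _, TopologicalSpace.isTopologicalBasis_opens, rfl⟩
  obtain ⟨D, hD, hDc⟩ := csInf_mem (s := {c | ∃ D : Set Y, Dense D ∧ #D = c})
    ⟨_, _, dense_univ, rfl⟩
  have hw : weight X = ℵ₀ + #B := by rw [weight, hBc]
  have hd : density Y = ℵ₀ + #D := by rw [density, hDc]
  rw [hw, hd]
  set R := Cardinal.lift.{v} (ℵ₀ + #B) * Cardinal.lift.{u} (ℵ₀ + #D) with hR
  have h1 : ℵ₀ ≤ Cardinal.lift.{v} (ℵ₀ + #B) := by simp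
  have h2 : ℵ₀ ≤ Cardinal.lift.{u} (ℵ₀ + #D) := by simp
  have hRω : ℵ₀ ≤ R := h1.trans (le_mul_right (aleph0_pos.trans_le h2).ne')
  have hBD : #(B × D) ≤ R := by
    rw [mk_prod]
    exact mul_le_mul' (lift_le.2 (self_le_add_left _ _)) (lift_le.2 (self_le_add_left _ _))
  have key : ∃ S : Set (X → Y), Dense S ∧ #S ≤ R := by
    by_cases hne : Nonempty (X → Y)
    · obtain ⟨g⟩ := hne
      refine ⟨_, dense_stepFun hB hD g, ?_⟩
      have h3 : #(List (B × D)) ≤ R := (mk_list_le_max _).trans (max_le hRω hBD)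
      refine le_trans ?_ h3
      simpa using mk_range_le (f := stepFun (B := B) (D := D) g)
    · refine ⟨∅, fun f => (hne ⟨f⟩).elim, by simp⟩
  obtain ⟨S, hS, hSR⟩ := key
  have h4 : sInf {c | ∃ D : Set (X → Y), Dense D ∧ #D = c} ≤ #S := csInf_le' ⟨S, hS, rfl⟩
  unfold density
  exact add_le_of_le hRω hRω (h4.trans hSR)
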